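/- arXiv:2403.19234 — 7 statements merged into one kernel-verified Lean document; each statement's English description precedes it below -/
import Mathlib

section
/- Let H be a real Hilbert space, Q a finite-dimensional real inner product space, Φ : Q → H twice continuously differentiable, f : H → H Lipschitz with constant L, and ε > 0. For r ∈ Q let M_ε(r) := Φ'(r)*Φ'(r) + ε² I (an invertible linear map on Q), let q̇(r) := M_ε(r)⁻¹ Φ'(r)* f(Φ(r)), and let δ(r)² := ‖Φ'(r)q̇(r) − f(Φ(r))‖² + ε²‖q̇(r)‖². Let q, q̃ ∈ Q, let β be an upper bound for ‖Φ''(r)‖ for all r on the line segment between q and q̃, and let δ̄ be an upper bound for δ(r) on that segment. Then ‖Φ'(q)q̇(q) − Φ'(q̃)q̇(q̃)‖ ≤ L‖Φ(q) − Φ(q̃)‖ + (5/2)·β·(δ̄/ε)·‖q − q̃‖. -/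
open Set

open ContinuousLinearMap in
theorem exists_reg {H Q : Type*} [NormedAddCommGroup H] [InnerProductSpace ℝ H] [CompleteSpace H]
    [NormedAddCommGroup Q] [InnerProductSpace ℝ Q] [FiniteDimensional ℝ Q]
    (A : Q →L[ℝ] H) (ε : ℝ) (hε : 0 < ε) (b : H) :
    ∃ z : Q, adjoint A (A z) + ε ^ 2 • z = adjoint A b := by
  let M : Q →ₗ[ℝ] Q := (adjoint A ∘L A + ε ^ 2 • ContinuousLinearMap.id ℝ Q : Q →L[ℝ] Q)
  have hM : ∀ z, M z = adjoint A (A z) + ε ^ 2 • z := fun z => rfl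
  have hinj : Function.Injective M := by
    rw [← LinearMap.ker_eq_bot, LinearMap.ker_eq_bot']
    intro z hz
    rw [hM] at hz
    have h := congrArg (fun t => inner ℝ t z) hz
    simp only [inner_add_left, adjoint_inner_left, inner_smul_left, inner_zero_left,
      real_inner_self_eq_norm_sq] at h
    simp only [conj_trivial] at h
    have h2 : ε ^ 2 * ‖z‖ ^ 2 = 0 := le_antisymm (by nlinarith [sq_nonneg ‖A z‖]) (by positivity)
    have h3 : ‖z‖ ^ 2 = 0 := by
      rcases mul_eq_zero.1 h2 with h | h
      · exact absurd h (by positivity)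
      · exact h
    exact norm_eq_zero.1 (pow_eq_zero_iff (two_ne_zero) |>.1 h3)
  obtain ⟨z, hz⟩ := LinearMap.injective_iff_surjective.1 hinj (adjoint A b)
  exact ⟨z, by rw [← hM, hz]⟩

open ContinuousLinearMap in
theorem reg_data {H Q : Type*} [NormedAddCommGroup H] [InnerProductSpace ℝ H] [CompleteSpace H]
    [NormedAddCommGroup Q] [InnerProductSpace ℝ Q] [FiniteDimensional ℝ Q]
    (A : Q →L[ℝ] H) (ε : ℝ) (a b : H) (x z : Q)
    (hx : adjoint A (A x) + ε ^ 2 • x = adjoint A a)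
    (hz : adjoint A (A z) + ε ^ 2 • z = adjoint A b) :
    ‖A x - A z‖ ≤ ‖a - b‖ := by
  have h : adjoint A (A (x - z)) + ε ^ 2 • (x - z) = adjoint A (a - b) := by
    rw [map_sub, map_sub, map_sub, ← hx, ← hz, smul_sub]; abel
  have h := congrArg (fun t => inner ℝ t (x - z)) h
  simp only [inner_add_left, adjoint_inner_left, inner_smul_left,
      real_inner_self_eq_norm_sq] at h
  simp only [conj_trivial] at h
  have h1 := real_inner_le_norm (a - b) (A (x - z))
  rw [← map_sub]
  by_contra hc
  push Not at hc
  have : 0 ≤ ε ^ 2 * ‖x - z‖ ^ 2 := by positivity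
  nlinarith [norm_nonneg (a - b)]

open ContinuousLinearMap in
theorem reg_op {H Q : Type*} [NormedAddCommGroup H] [InnerProductSpace ℝ H] [CompleteSpace H]
    [NormedAddCommGroup Q] [InnerProductSpace ℝ Q] [FiniteDimensional ℝ Q]
    (A B : Q →L[ℝ] H) (ε : ℝ) (hε : 0 < ε) (b : H) (y z : Q) (d : ℝ)
    (hy : adjoint B (B y) + ε ^ 2 • y = adjoint B b)
    (hz : adjoint A (A z) + ε ^ 2 • z = adjoint A b)
    (h1 : ‖B y - b‖ ≤ d) (h2 : ε * ‖y‖ ≤ d) :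
    ε * ‖A z - B y‖ ≤ 5 / 2 * (‖A - B‖ * d) := by
  set w := A z - B y with hw
  set g := b - B y with hg
  have hg' : ‖g‖ ≤ d := by rw [hg, norm_sub_rev]; exact h1
  have hBg : adjoint B g = ε ^ 2 • y := by rw [hg, map_sub, ← hy]; abel
  have hAg : adjoint A g = adjoint A w + ε ^ 2 • z := by
    rw [hg, hw, map_sub, map_sub, ← hz]; abel
  have key : A (adjoint A w) + ε ^ 2 • w = A (adjoint (A - B) g) + ε ^ 2 • ((A - B) y) := by
    rw [map_sub (adjoint (𝕜 := ℝ) (E := Q) (F := H)), sub_apply, sub_apply, hAg, hBg, hw]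
    simp only [map_add, map_sub, map_smul, smul_sub]
    abel
  have key := congrArg (fun t => inner ℝ t w) key
  simp only [inner_add_left, inner_smul_left, conj_trivial, ← adjoint_inner_right A,
      real_inner_self_eq_norm_sq] at key
  have e1 : inner ℝ (adjoint (A - B) g) (adjoint A w) ≤ ‖A - B‖ * d * ‖adjoint A w‖ := by
    refine (real_inner_le_norm _ _).trans ?_
    gcongr
    refine (le_opNorm _ _).trans ?_
    rw [LinearIsometryEquiv.norm_map]
    gcongr
  have e2 : ε ^ 2 * inner ℝ ((A - B) y) w ≤ ‖A - B‖ * d * (ε * ‖w‖) := by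
    calc ε ^ 2 * inner ℝ ((A - B) y) w ≤ ε ^ 2 * (‖A - B‖ * ‖y‖ * ‖w‖) := by
          gcongr
          refine (real_inner_le_norm _ _).trans ?_
          gcongr
          exact le_opNorm _ _
      _ = ‖A - B‖ * (ε * ‖y‖) * (ε * ‖w‖) := by ring
      _ ≤ _ := by gcongr
  have hd : 0 ≤ d := (norm_nonneg _).trans h1
  have hK : 0 ≤ ‖A - B‖ * d := by positivity
  generalize ‖A - B‖ * d = K at *
  generalize ‖adjoint A w‖ = s at *
  have ht : (ε * ‖w‖) ^ 2 = ε ^ 2 * ‖w‖ ^ 2 := by ring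
  rw [← ht] at key
  generalize ε * ‖w‖ = t at *
  by_contra hc
  push Not at hc
  nlinarith [sq_nonneg (s - K / 2)]

/-- Sensitivity of `u̇ = Φ'(q)q̇(q)` with respect to the parameter `q`, where `q̇(q)` solves
the regularized least squares problem (normal equations `M_ε(q) q̇(q) = Φ'(q)* f(Φ(q))`). -/
theorem stmt_5 {H Q : Type*} [NormedAddCommGroup H] [InnerProductSpace ℝ H] [CompleteSpace H]
    [NormedAddCommGroup Q] [InnerProductSpace ℝ Q] [FiniteDimensional ℝ Q]
    (Φ : Q → H) (hΦ : ContDiff ℝ 2 Φ)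
    (f : H → H) (L : ℝ) (hf : ∀ v w : H, ‖f v - f w‖ ≤ L * ‖v - w‖)
    (ε : ℝ) (hε : 0 < ε)
    (qdot : Q → Q)
    (hnormal : ∀ r : Q,
      ContinuousLinearMap.adjoint (fderiv ℝ Φ r) (fderiv ℝ Φ r (qdot r)) + ε ^ 2 • qdot r
        = ContinuousLinearMap.adjoint (fderiv ℝ Φ r) (f (Φ r)))
    (δ : Q → ℝ)
    (hδ : ∀ r : Q, δ r =
      Real.sqrt (‖fderiv ℝ Φ r (qdot r) - f (Φ r)‖ ^ 2 + ε ^ 2 * ‖qdot r‖ ^ 2))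
    (q qt : Q) (β δbar : ℝ)
    (hβ : ∀ r ∈ segment ℝ q qt, ‖iteratedFDeriv ℝ 2 Φ r‖ ≤ β)
    (hδbar : ∀ r ∈ segment ℝ q qt, δ r ≤ δbar) :
    ‖fderiv ℝ Φ q (qdot q) - fderiv ℝ Φ qt (qdot qt)‖ ≤
      L * ‖Φ q - Φ qt‖ + (5 / 2) * β * (δbar / ε) * ‖q - qt‖ := by
  set A := fderiv ℝ Φ q with hA
  set B := fderiv ℝ Φ qt with hB
  obtain ⟨z, hz⟩ := exists_reg A ε hε (f (Φ qt))
  have hq : q ∈ segment ℝ q qt := left_mem_segment ℝ q qt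
  have hqt : qt ∈ segment ℝ q qt := right_mem_segment ℝ q qt
  have hd := hδbar qt hqt
  rw [hδ qt, ← hB] at hd
  have hd1 : ‖B (qdot qt) - f (Φ qt)‖ ≤ δbar :=
    (Real.le_sqrt_of_sq_le (by nlinarith [sq_nonneg (ε * ‖qdot qt‖)])).trans hd
  have hd2 : ε * ‖qdot qt‖ ≤ δbar :=
    (Real.le_sqrt_of_sq_le (by
      nlinarith [sq_nonneg ‖B (qdot qt) - f (Φ qt)‖])).trans hd
  have hd0 : 0 ≤ δbar := (norm_nonneg _).trans hd1
  have s1 := reg_data A ε (f (Φ q)) (f (Φ qt)) (qdot q) z (hnormal q) hz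
  have s2 := reg_op A B ε hε (f (Φ qt)) (qdot qt) z δbar (hnormal qt) hz hd1 hd2
  have hdiff : Differentiable ℝ (fderiv ℝ Φ) :=
    (hΦ.fderiv_right (m := 1) (by norm_num)).differentiable (by norm_num)
  have s3 : ‖A - B‖ ≤ β * ‖q - qt‖ := by
    refine Convex.norm_image_sub_le_of_norm_fderiv_le (𝕜 := ℝ) (f := fderiv ℝ Φ)
      (fun x _ => hdiff x) (fun x hx => ?_) (convex_segment q qt) hqt hq
    have := hβ x hx
    rw [← norm_iteratedFDeriv_fderiv, norm_iteratedFDeriv_one] at this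
    exact this
  have s4 : ‖A z - B (qdot qt)‖ ≤ (5 / 2) * β * (δbar / ε) * ‖q - qt‖ := by
    have e : (5 / 2) * β * (δbar / ε) * ‖q - qt‖ = (5 / 2 * (β * ‖q - qt‖ * δbar)) / ε := by
      ring
    rw [e, le_div_iff₀ hε, mul_comm]
    refine s2.trans ?_
    gcongr
  calc ‖A (qdot q) - B (qdot qt)‖ = ‖(A (qdot q) - A z) + (A z - B (qdot qt))‖ := by
        congr 1; abel
    _ ≤ ‖A (qdot q) - A z‖ + ‖A z - B (qdot qt)‖ := norm_add_le _ _
    _ ≤ _ := add_le_add (s1.trans (hf _ _)) s4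
end

section
/- Let H be a real Hilbert space, Q a finite-dimensional real inner product space, Φ : Q → H twice continuously differentiable, f : H → H Lipschitz with constant L, and ε > 0. For r ∈ Q let M_ε(r) := Φ'(r)*Φ'(r) + ε² I, q̇(r) := M_ε(r)⁻¹ Φ'(r)* f(Φ(r)), and δ(r)² := ‖Φ'(r)q̇(r) − f(Φ(r))‖² + ε²‖q̇(r)‖². Let q, q̃ ∈ Q, let β be an upper bound for ‖Φ''(r)‖ on the line segment between q and q̃, and let δ̄ be an upper bound for δ(r) on that segment. Then ε‖q̇(q) − q̇(q̃)‖ ≤ L‖Φ(q) − Φ(q̃)‖ + (5/2)·β·(δ̄/ε)·‖q − q̃‖. -/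
open Set

theorem core_bound {H Q : Type*} [NormedAddCommGroup H] [InnerProductSpace ℝ H]
    [NormedAddCommGroup Q] [InnerProductSpace ℝ Q] (A B : Q →L[ℝ] H) (u w : H) (x y : Q)
    (ε h d : ℝ) (hε : 0 < ε) (hd : 0 ≤ d) (hD : ‖A - B‖ ≤ h)
    (hdsq : d ^ 2 = ‖B y - w‖ ^ 2 + ε ^ 2 * ‖y‖ ^ 2)
    (nA : inner ℝ (A x) (A (x - y)) + ε ^ 2 * inner ℝ x (x - y) = inner ℝ u (A (x - y)))
    (nB : inner ℝ (B y) (B (x - y)) + ε ^ 2 * inner ℝ y (x - y) = inner ℝ w (B (x - y))) :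
    ε * ‖x - y‖ ≤ ‖u - w‖ + h / ε * d := by
  have hh : 0 ≤ h := (norm_nonneg _).trans hD
  set R : H := (u - A x) - (w - B y) with hR
  have key : ε ^ 2 * ‖x - y‖ ^ 2 + ‖R‖ ^ 2
      = inner ℝ R (u - w) - inner ℝ R ((A - B) y) + inner ℝ (w - B y) ((A - B) (x - y)) := by
    have e1 : ‖x - y‖ ^ 2 = inner ℝ x (x - y) - inner ℝ y (x - y) := by
      rw [← inner_sub_left, real_inner_self_eq_norm_sq]
    have e2 : A (x - y) = (u - w) - R - (A - B) y := by
      rw [hR]; simp only [map_sub, ContinuousLinearMap.sub_apply]; abel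
    have e3 : inner ℝ R (A (x - y)) = inner ℝ R (u - w) - ‖R‖ ^ 2 - inner ℝ R ((A - B) y) := by
      rw [e2, inner_sub_right, inner_sub_right, real_inner_self_eq_norm_sq]
    have e4 : inner ℝ R (A (x - y)) = inner ℝ u (A (x - y)) - inner ℝ (A x) (A (x - y))
        - inner ℝ (w - B y) (A (x - y)) := by
      rw [hR, inner_sub_left (u - A x), inner_sub_left u]
    have e5 : inner ℝ (w - B y) ((A - B) (x - y)) = inner ℝ (w - B y) (A (x - y))
        - (inner ℝ w (B (x - y)) - inner ℝ (B y) (B (x - y))) := by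
      rw [ContinuousLinearMap.sub_apply, inner_sub_right, inner_sub_left w (B y) (B (x - y))]
    rw [e1]
    linarith
  have b1 : inner ℝ R (u - w) ≤ ‖R‖ * ‖u - w‖ := real_inner_le_norm _ _
  have b2 : -inner ℝ R ((A - B) y) ≤ ‖R‖ * (h * ‖y‖) := by
    refine (neg_le_abs _).trans ((abs_real_inner_le_norm _ _).trans ?_)
    exact mul_le_mul_of_nonneg_left ((A - B).le_of_opNorm_le hD y) (norm_nonneg _)
  have b3 : inner ℝ (w - B y) ((A - B) (x - y)) ≤ ‖B y - w‖ * (h * ‖x - y‖) := by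
    rw [norm_sub_rev (B y)]
    refine (real_inner_le_norm _ _).trans ?_
    exact mul_le_mul_of_nonneg_left ((A - B).le_of_opNorm_le hD _) (norm_nonneg _)
  have n1 := norm_nonneg R
  have n2 := norm_nonneg (u - w)
  have n3 := norm_nonneg (x - y)
  generalize ‖R‖ = r at *
  generalize ‖u - w‖ = F at *
  generalize ‖x - y‖ = z at *
  generalize ‖B y - w‖ = p at *
  generalize ‖y‖ = v at *
  set S := Real.sqrt (r ^ 2 + (ε * z) ^ 2) with hS
  have hS0 : 0 ≤ S := Real.sqrt_nonneg _
  have hS2 : S ^ 2 = r ^ 2 + (ε * z) ^ 2 := Real.sq_sqrt (by positivity)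
  have hrS : r ≤ S := Real.le_sqrt_of_sq_le (by nlinarith [sq_nonneg (ε * z)])
  have hzS : ε * z ≤ S := Real.le_sqrt_of_sq_le (by nlinarith [sq_nonneg r])
  have cs : r * (ε * v) + p * (ε * z) ≤ S * d := by
    refine abs_le_of_sq_le_sq' ?_ (by positivity) |>.2
    rw [mul_pow, hS2, hdsq]
    nlinarith [sq_nonneg (r * p - (ε * v) * (ε * z))]
  have hm : S ^ 2 ≤ S * (F + h / ε * d) := by
    have a1 : r * (h * v) + p * (h * z) = h / ε * (r * (ε * v) + p * (ε * z)) := by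
      field_simp
    have a2 : h / ε * (r * (ε * v) + p * (ε * z)) ≤ h / ε * (S * d) :=
      mul_le_mul_of_nonneg_left cs (by positivity)
    have a3 : r * F ≤ S * F := mul_le_mul_of_nonneg_right hrS n2
    nlinarith
  have hG : 0 ≤ F + h / ε * d := by positivity
  refine hzS.trans ?_
  by_contra hlt
  push Not at hlt
  nlinarith

/-- Sensitivity of `εq̇(q)` with respect to the parameter `q`, where `q̇(q)` solves
the regularized least squares problem (normal equations `M_ε(q) q̇(q) = Φ'(q)* f(Φ(q))`). -/
theorem stmt_6 {H Q : Type*} [NormedAddCommGroup H] [InnerProductSpace ℝ H] [CompleteSpace H]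
    [NormedAddCommGroup Q] [InnerProductSpace ℝ Q] [FiniteDimensional ℝ Q]
    (Φ : Q → H) (hΦ : ContDiff ℝ 2 Φ)
    (f : H → H) (L : ℝ) (hf : ∀ v w : H, ‖f v - f w‖ ≤ L * ‖v - w‖)
    (ε : ℝ) (hε : 0 < ε)
    (qdot : Q → Q)
    (hnormal : ∀ r : Q,
      ContinuousLinearMap.adjoint (fderiv ℝ Φ r) (fderiv ℝ Φ r (qdot r)) + ε ^ 2 • qdot r
        = ContinuousLinearMap.adjoint (fderiv ℝ Φ r) (f (Φ r)))
    (δ : Q → ℝ)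
    (hδ : ∀ r : Q, δ r =
      Real.sqrt (‖fderiv ℝ Φ r (qdot r) - f (Φ r)‖ ^ 2 + ε ^ 2 * ‖qdot r‖ ^ 2))
    (q qt : Q) (β δbar : ℝ)
    (hβ : ∀ r ∈ segment ℝ q qt, ‖iteratedFDeriv ℝ 2 Φ r‖ ≤ β)
    (hδbar : ∀ r ∈ segment ℝ q qt, δ r ≤ δbar) :
    ε * ‖qdot q - qdot qt‖ ≤
      L * ‖Φ q - Φ qt‖ + (5 / 2) * β * (δbar / ε) * ‖q - qt‖ := by
  have hD : ‖fderiv ℝ Φ q - fderiv ℝ Φ qt‖ ≤ β * ‖q - qt‖ := by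
    have hd : Differentiable ℝ (fderiv ℝ Φ) :=
      (hΦ.fderiv_right (m := 1) (by norm_num)).differentiable (by norm_num)
    refine (convex_segment q qt).norm_image_sub_le_of_norm_hasFDerivWithin_le
      (f' := fun r => fderiv ℝ (fderiv ℝ Φ) r)
      (fun r _ => (hd r).hasFDerivAt.hasFDerivWithinAt) ?_
      (right_mem_segment ℝ q qt) (left_mem_segment ℝ q qt)
    intro r hr
    have h1 := hβ r hr
    have h2 : ‖iteratedFDeriv ℝ 1 (fderiv ℝ Φ) r‖ = ‖iteratedFDeriv ℝ 2 Φ r‖ :=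
      norm_iteratedFDeriv_fderiv
    rw [← h2, norm_iteratedFDeriv_one] at h1
    exact h1
  have hβ0 : 0 ≤ β := (norm_nonneg _).trans (hβ q (left_mem_segment ℝ q qt))
  have hδt := hδbar qt (right_mem_segment ℝ q qt)
  have hδ0 : 0 ≤ δ qt := by rw [hδ]; exact Real.sqrt_nonneg _
  have hδsq : δ qt ^ 2 = ‖fderiv ℝ Φ qt (qdot qt) - f (Φ qt)‖ ^ 2 + ε ^ 2 * ‖qdot qt‖ ^ 2 := by
    rw [hδ]; exact Real.sq_sqrt (by positivity)
  have hF := hf (Φ q) (Φ qt)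
  have nA := congrArg (fun z => inner ℝ z (qdot q - qdot qt)) (hnormal q)
  have nB := congrArg (fun z => inner ℝ z (qdot q - qdot qt)) (hnormal qt)
  simp only [inner_add_left, ContinuousLinearMap.adjoint_inner_left, real_inner_smul_left] at nA nB
  have hc := core_bound (fderiv ℝ Φ q) (fderiv ℝ Φ qt) (f (Φ q)) (f (Φ qt)) (qdot q) (qdot qt)
    ε (β * ‖q - qt‖) (δ qt) hε hδ0 hD hδsq nA nB
  have h3 : β * ‖q - qt‖ / ε * δ qt ≤ β * ‖q - qt‖ / ε * δbar :=
    mul_le_mul_of_nonneg_left hδt (by positivity)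
  have h4 : 0 ≤ β * ‖q - qt‖ / ε * δbar := le_trans (by positivity) h3
  have h5 : (5 / 2) * β * (δbar / ε) * ‖q - qt‖ = (5 / 2) * (β * ‖q - qt‖ / ε * δbar) := by ring
  rw [h5]
  linarith
end

section
/- Let H be a real Hilbert space, Q a finite-dimensional real inner product space, Φ : Q → H twice continuously differentiable, f : H → H Lipschitz with constant L, and ε > 0. For r ∈ Q let M_ε(r) := Φ'(r)*Φ'(r) + ε² I, q̇(r) := M_ε(r)⁻¹ Φ'(r)* f(Φ(r)), and δ(r)² := ‖Φ'(r)q̇(r) − f(Φ(r))‖² + ε²‖q̇(r)‖². Let q, q̃ ∈ Q, let β be an upper bound for ‖Φ''(r)‖ on the line segment between q and q̃, and let δ̄ be an upper bound for δ(r) on that segment. Then |δ(q) − δ(q̃)| ≤ 3L‖Φ(q) − Φ(q̃)‖ + 5·β·(δ̄/ε)·‖q − q̃‖. -/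
open Set


theorem aux_min {H Q : Type*} [NormedAddCommGroup H] [InnerProductSpace ℝ H] [CompleteSpace H]
    [NormedAddCommGroup Q] [InnerProductSpace ℝ Q] [CompleteSpace Q]
    (A : Q →L[ℝ] H) (b : H) (ε : ℝ) (p v : Q)
    (hn : ContinuousLinearMap.adjoint A (A p) + ε ^ 2 • p = ContinuousLinearMap.adjoint A b) :
    ‖A p - b‖ ^ 2 + ε ^ 2 * ‖p‖ ^ 2 ≤ ‖A v - b‖ ^ 2 + ε ^ 2 * ‖v‖ ^ 2 := by
  obtain ⟨w, rfl⟩ : ∃ w, v = p + w := ⟨v - p, by abel⟩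
  have h1 : A (p + w) - b = (A p - b) + A w := by rw [map_add]; abel
  have h2 : inner ℝ (A p - b) (A w) + ε ^ 2 * inner ℝ p w = 0 := by
    have h3 := congrArg (fun x => inner ℝ x w) hn
    simp only [inner_add_left, inner_smul_left, ContinuousLinearMap.adjoint_inner_left] at h3
    rw [inner_sub_left]
    simp at h3
    linarith
  rw [h1, norm_add_sq_real, norm_add_sq_real]
  have h4 : 0 ≤ ε ^ 2 * ‖w‖ ^ 2 := by positivity
  nlinarith [sq_nonneg ‖A w‖]

theorem aux_sqrt (a a' c d : ℝ) (ha : 0 ≤ a) (ha' : 0 ≤ a') (hc : 0 ≤ c) (hd : 0 ≤ d)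
    (h : a' ≤ a + d) : Real.sqrt (a' ^ 2 + c) ≤ Real.sqrt (a ^ 2 + c) + d := by
  have h1 : a ≤ Real.sqrt (a ^ 2 + c) := Real.le_sqrt_of_sq_le (by linarith)
  have h2 : Real.sqrt (a ^ 2 + c) ^ 2 = a ^ 2 + c := Real.sq_sqrt (by positivity)
  rw [Real.sqrt_le_iff]
  refine ⟨by positivity, ?_⟩
  nlinarith [mul_nonneg (sub_nonneg.2 h1) hd, mul_self_le_mul_self ha' h]

theorem aux_one {H Q : Type*} [NormedAddCommGroup H] [InnerProductSpace ℝ H] [CompleteSpace H]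
    [NormedAddCommGroup Q] [InnerProductSpace ℝ Q] [CompleteSpace Q]
    (A B : Q →L[ℝ] H) (b c : H) (ε k l : ℝ) (p v : Q) (D : ℝ) (hε : 0 < ε)
    (hn : ContinuousLinearMap.adjoint A (A p) + ε ^ 2 • p = ContinuousLinearMap.adjoint A b)
    (hk : ‖A - B‖ ≤ k) (hl : ‖b - c‖ ≤ l)
    (hD : Real.sqrt (‖B v - c‖ ^ 2 + ε ^ 2 * ‖v‖ ^ 2) ≤ D) :
    Real.sqrt (‖A p - b‖ ^ 2 + ε ^ 2 * ‖p‖ ^ 2) ≤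
      Real.sqrt (‖B v - c‖ ^ 2 + ε ^ 2 * ‖v‖ ^ 2) + (k * (D / ε) + l) := by
  have hv : ‖v‖ ≤ D / ε := by
    rw [le_div_iff₀ hε]
    refine le_trans (Real.le_sqrt_of_sq_le ?_) hD
    nlinarith [sq_nonneg ‖B v - c‖]
  have hk0 : 0 ≤ k := (norm_nonneg _).trans hk
  have hl0 : 0 ≤ l := (norm_nonneg _).trans hl
  have hD0 : 0 ≤ D / ε := (norm_nonneg _).trans hv
  refine (Real.sqrt_le_sqrt (aux_min A b ε p v hn)).trans ?_
  apply aux_sqrt _ _ _ _ (norm_nonneg _) (norm_nonneg _) (by positivity) (by positivity)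
  have e : A v - b = (B v - c) + ((A - B) v - (b - c)) := by
    simp only [ContinuousLinearMap.sub_apply]; abel
  rw [e]
  refine (norm_add_le _ _).trans ?_
  gcongr
  refine (norm_sub_le _ _).trans ?_
  gcongr
  refine ((A - B).le_opNorm v).trans ?_
  gcongr

/-- Sensitivity of `u̇ = Φ'(q)q̇(q)` with respect to the parameter `q`, where `q̇(q)` solves
the regularized least squares problem (normal equations `M_ε(q) q̇(q) = Φ'(q)* f(Φ(q))`). -/
theorem stmt_7 {H Q : Type*} [NormedAddCommGroup H] [InnerProductSpace ℝ H] [CompleteSpace H]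
    [NormedAddCommGroup Q] [InnerProductSpace ℝ Q] [FiniteDimensional ℝ Q]
    (Φ : Q → H) (hΦ : ContDiff ℝ 2 Φ)
    (f : H → H) (L : ℝ) (hf : ∀ v w : H, ‖f v - f w‖ ≤ L * ‖v - w‖)
    (ε : ℝ) (hε : 0 < ε)
    (qdot : Q → Q)
    (hnormal : ∀ r : Q,
      ContinuousLinearMap.adjoint (fderiv ℝ Φ r) (fderiv ℝ Φ r (qdot r)) + ε ^ 2 • qdot r
        = ContinuousLinearMap.adjoint (fderiv ℝ Φ r) (f (Φ r)))
    (δ : Q → ℝ)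
    (hδ : ∀ r : Q, δ r =
      Real.sqrt (‖fderiv ℝ Φ r (qdot r) - f (Φ r)‖ ^ 2 + ε ^ 2 * ‖qdot r‖ ^ 2))
    (q qt : Q) (β δbar : ℝ)
    (hβ : ∀ r ∈ segment ℝ q qt, ‖iteratedFDeriv ℝ 2 Φ r‖ ≤ β)
    (hδbar : ∀ r ∈ segment ℝ q qt, δ r ≤ δbar) :
    |δ q - δ qt| ≤
      3 * L * ‖Φ q - Φ qt‖ + 5 * β * (δbar / ε) * ‖q - qt‖ := by
  have : CompleteSpace Q := FiniteDimensional.complete ℝ Q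
  have hd : ContDiff ℝ 1 (fderiv ℝ Φ) := hΦ.fderiv_right (by norm_num)
  have hk : ‖fderiv ℝ Φ q - fderiv ℝ Φ qt‖ ≤ β * ‖q - qt‖ := by
    refine Convex.norm_image_sub_le_of_norm_fderiv_le (𝕜 := ℝ) (s := segment ℝ q qt)
      (fun x _ => (hd.differentiable (by norm_num)) x) (fun x hx => ?_) (convex_segment q qt)
      (right_mem_segment ℝ q qt) (left_mem_segment ℝ q qt)
    rw [← norm_iteratedFDeriv_one, norm_iteratedFDeriv_fderiv]
    exact hβ x hx
  have hl := hf (Φ q) (Φ qt)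
  have hk' := hk
  have hl' := hl
  rw [norm_sub_rev] at hk' hl'
  have hq := hδbar q (left_mem_segment ℝ q qt)
  have hqt := hδbar qt (right_mem_segment ℝ q qt)
  rw [hδ] at hq hqt
  have h1 := aux_one _ _ _ _ ε _ _ _ _ δbar hε (hnormal q) hk hl hqt
  have h2 := aux_one _ _ _ _ ε _ _ _ _ δbar hε (hnormal qt) hk' hl' hq
  rw [← hδ, ← hδ] at h1 h2
  have hl0 : 0 ≤ L * ‖Φ q - Φ qt‖ := (norm_nonneg _).trans hl
  have hk0 : 0 ≤ β * ‖q - qt‖ := (norm_nonneg _).trans hk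
  have hD0 : 0 ≤ δbar / ε := div_nonneg ((Real.sqrt_nonneg _).trans hq) hε.le
  have h3 := mul_nonneg hk0 hD0
  have e : 5 * β * (δbar / ε) * ‖q - qt‖ = 5 * (β * ‖q - qt‖ * (δbar / ε)) := by ring
  rw [abs_le, e]
  constructor <;> linarith
end

section
/- Let H be a real Hilbert space, Q a finite-dimensional real inner product space, A : Q → H a fixed linear map, f : H → H Lipschitz with constant L, and ε > 0. Set M_ε := A*A + ε² I and P_ε := A M_ε⁻¹ A*. Let q, q̃ : [0, T] → Q be differentiable with q'(t) = M_ε⁻¹ A* f(A q(t)) and q̃'(t) = M_ε⁻¹ A* f(A q̃(t)), and put u(t) = A q(t), ũ(t) = A q̃(t). Then for all t ∈ [0, T], ‖u(t) − ũ(t)‖ ≤ e^{Lt} ‖u(0) − ũ(0)‖. -/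
open Set

/-- For a linear parametrization `Φ(q) = Aq`, the regularized dynamical approximations
`u = Aq` propagate initial errors with the Lipschitz constant `L` of `f` only:
`‖u(t) − ũ(t)‖ ≤ e^{Lt}‖u(0) − ũ(0)‖`, independently of `ε`. -/
theorem stmt_8 {H Q : Type*} [NormedAddCommGroup H] [InnerProductSpace ℝ H] [CompleteSpace H]
    [NormedAddCommGroup Q] [InnerProductSpace ℝ Q] [FiniteDimensional ℝ Q]
    (A : Q →L[ℝ] H) (f : H → H) (L : ℝ)
    (hf : ∀ v w : H, ‖f v - f w‖ ≤ L * ‖v - w‖)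
    (ε : ℝ) (hε : 0 < ε) (T : ℝ)
    (q qt : ℝ → Q) (dq dqt : ℝ → Q)
    (hq : ∀ t ∈ Icc (0:ℝ) T, HasDerivAt q (dq t) t)
    (hqt : ∀ t ∈ Icc (0:ℝ) T, HasDerivAt qt (dqt t) t)
    (hnq : ∀ t ∈ Icc (0:ℝ) T,
      ContinuousLinearMap.adjoint A (A (dq t)) + ε ^ 2 • dq t
        = ContinuousLinearMap.adjoint A (f (A (q t))))
    (hnqt : ∀ t ∈ Icc (0:ℝ) T,
      ContinuousLinearMap.adjoint A (A (dqt t)) + ε ^ 2 • dqt t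
        = ContinuousLinearMap.adjoint A (f (A (qt t)))) :
    ∀ t ∈ Icc (0:ℝ) T, ‖A (q t) - A (qt t)‖ ≤ Real.exp (L * t) * ‖A (q 0) - A (qt 0)‖ := by
  have hd : ∀ t ∈ Icc (0:ℝ) T,
      HasDerivAt (fun t => A (q t) - A (qt t)) (A (dq t) - A (dqt t)) t := fun t ht =>
    (A.hasFDerivAt.comp_hasDerivAt t (hq t ht)).sub (A.hasFDerivAt.comp_hasDerivAt t (hqt t ht))
  have hb : ∀ t ∈ Icc (0:ℝ) T, ‖A (dq t) - A (dqt t)‖ ≤ L * ‖A (q t) - A (qt t)‖ + 0 := by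
    intro t ht
    rw [add_zero]
    refine le_trans ?_ (hf _ _)
    set w := dq t - dqt t with hw
    set g := f (A (q t)) - f (A (qt t)) with hg
    have hAw : A (dq t) - A (dqt t) = A w := by rw [hw, map_sub]
    have e : ContinuousLinearMap.adjoint A (A w) + ε ^ 2 • w
        = ContinuousLinearMap.adjoint A g := by
      rw [hw, hg, map_sub, map_sub, map_sub, ← hnq t ht, ← hnqt t ht, smul_sub]
      abel
    have e2 := congrArg (fun x => inner ℝ x w) e
    simp only [inner_add_left, ContinuousLinearMap.adjoint_inner_left, real_inner_smul_left,
      real_inner_self_eq_norm_sq] at e2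
    have h3 := real_inner_le_norm g (A w)
    rw [hAw]
    have h4 : 0 ≤ ε ^ 2 * ‖w‖ ^ 2 := by positivity
    by_contra! h
    nlinarith [norm_nonneg g, norm_nonneg (A w)]
  intro t ht
  have := norm_le_gronwallBound_of_norm_deriv_right_le
    (fun t ht => (hd t ht).continuousAt.continuousWithinAt)
    (fun t ht => (hd t (Ico_subset_Icc_self ht)).hasDerivWithinAt) le_rfl
    (fun t ht => hb t (Ico_subset_Icc_self ht)) t ht
  rw [gronwallBound_ε0, sub_zero, mul_comm] at this
  exact this
end

section
/- Let H be a real Hilbert space, Q a finite-dimensional real inner product space, Φ : Q → H twice continuously differentiable, f : H → H, and let ε₀ > 0, h > 0, c > 0. Let q₀ ∈ Q, let q̇₀ be the unique minimizer over v ∈ Q of ‖Φ'(q₀)v − f(Φ(q₀))‖² + ε₀²‖v‖², with minimum value δ₀², and set q₁ = q₀ + h q̇₀ and u₁ = Φ(q₁). Let y be twice differentiable on [t₀, t₀ + h] with y'(t) = f(y(t)), y(t₀) = Φ(q₀), and ‖y''(t)‖ ≤ 2c₂ on [t₀, t₀ + h]. Let β be an upper bound for ‖Φ''(r)‖ for r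 on the segment between q₀ and q₁. If h δ₀ ≤ c ε₀², then ‖u₁ − y(t₀ + h)‖ ≤ (1 + cβ) h δ₀ + c₂ h². -/
open Set

theorem taylor_aux {E : Type*} [NormedAddCommGroup E] [NormedSpace ℝ E]
    (g g' g'' : ℝ → E) (a h C : ℝ) (hh : 0 < h)
    (h1 : ∀ t ∈ Icc a (a + h), HasDerivAt g (g' t) t)
    (h2 : ∀ t ∈ Icc a (a + h), HasDerivAt g' (g'' t) t)
    (hb : ∀ t ∈ Icc a (a + h), ‖g'' t‖ ≤ 2 * C) :
    ‖g (a + h) - g a - h • g' a‖ ≤ C * h ^ 2 := by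
  have hm : ∀ t ∈ Icc a (a + h), ‖g' t - g' a‖ ≤ 2 * C * (t - a) :=
    norm_image_sub_le_of_norm_deriv_le_segment' (fun t ht => (h2 t ht).hasDerivWithinAt)
      (fun t ht => hb t (Ico_subset_Icc_self ht))
  have hd : ∀ t ∈ Icc a (a + h),
      HasDerivAt (fun t => g t - g a - (t - a) • g' a) (g' t - g' a) t := by
    intro t ht
    have := ((h1 t ht).sub_const (g a)).sub (((hasDerivAt_id t).sub_const a).smul_const (g' a))
    rw [one_smul] at this
    exact this
  have hB : ∀ t : ℝ, HasDerivAt (fun t => C * (t - a) ^ 2) (2 * C * (t - a)) t := by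
    intro t
    have := (((hasDerivAt_id t).sub_const a).pow 2).const_mul C
    refine this.congr_deriv ?_
    simp only [id]
    push_cast
    ring
  have := image_norm_le_of_norm_deriv_right_le_deriv_boundary
    (f := fun t => g t - g a - (t - a) • g' a) (f' := fun t => g' t - g' a)
    (a := a) (b := a + h) (B := fun t => C * (t - a) ^ 2) (B' := fun t => 2 * C * (t - a))
    (fun t ht => (hd t ht).continuousAt.continuousWithinAt)
    (fun t ht => (hd t (Ico_subset_Icc_self ht)).hasDerivWithinAt)
    (by simp) hB (fun t ht => hm t (Ico_subset_Icc_self ht))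
    (right_mem_Icc.2 (by linarith))
  simpa using this

/-- Local error bound of the regularized explicit Euler method: under the stepsize
restriction `h δ₀ ≤ c ε₀²`, one step satisfies
`‖u₁ − y(t₀ + h)‖ ≤ (1 + cβ) h δ₀ + c₂ h²`. -/
theorem stmt_9 {H Q : Type*} [NormedAddCommGroup H] [InnerProductSpace ℝ H] [CompleteSpace H]
    [NormedAddCommGroup Q] [InnerProductSpace ℝ Q] [FiniteDimensional ℝ Q]
    (Φ : Q → H) (hΦ : ContDiff ℝ 2 Φ) (f : H → H)
    (ε₀ h c c₂ β : ℝ) (hε : 0 < ε₀) (hh : 0 < h) (hc : 0 < c)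
    (t₀ : ℝ) (q₀ qd₀ : Q)
    (hmin : ∀ v : Q,
      ‖fderiv ℝ Φ q₀ qd₀ - f (Φ q₀)‖ ^ 2 + ε₀ ^ 2 * ‖qd₀‖ ^ 2 ≤
        ‖fderiv ℝ Φ q₀ v - f (Φ q₀)‖ ^ 2 + ε₀ ^ 2 * ‖v‖ ^ 2)
    (δ₀ : ℝ)
    (hδ₀ : δ₀ = Real.sqrt (‖fderiv ℝ Φ q₀ qd₀ - f (Φ q₀)‖ ^ 2 + ε₀ ^ 2 * ‖qd₀‖ ^ 2))
    (y dy2 : ℝ → H)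
    (hy : ∀ t ∈ Icc t₀ (t₀ + h), HasDerivAt y (f (y t)) t)
    (hy2 : ∀ t ∈ Icc t₀ (t₀ + h), HasDerivAt (fun s => f (y s)) (dy2 t) t)
    (hy2b : ∀ t ∈ Icc t₀ (t₀ + h), ‖dy2 t‖ ≤ 2 * c₂)
    (hy0 : y t₀ = Φ q₀)
    (hβ : ∀ r ∈ segment ℝ q₀ (q₀ + h • qd₀), ‖iteratedFDeriv ℝ 2 Φ r‖ ≤ β)
    (hstep : h * δ₀ ≤ c * ε₀ ^ 2) :
    ‖Φ (q₀ + h • qd₀) - y (t₀ + h)‖ ≤ (1 + c * β) * h * δ₀ + c₂ * h ^ 2 := by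
  have hδn : 0 ≤ δ₀ := hδ₀ ▸ Real.sqrt_nonneg _
  have hδsq : δ₀ ^ 2 = ‖fderiv ℝ Φ q₀ qd₀ - f (Φ q₀)‖ ^ 2 + ε₀ ^ 2 * ‖qd₀‖ ^ 2 := by
    rw [hδ₀, Real.sq_sqrt (by positivity)]
  have hdef : ‖fderiv ℝ Φ q₀ qd₀ - f (Φ q₀)‖ ≤ δ₀ := by
    apply le_of_sq_le_sq _ hδn
    have : 0 ≤ ε₀ ^ 2 * ‖qd₀‖ ^ 2 := by positivity
    linarith
  have hq : ε₀ ^ 2 * ‖qd₀‖ ^ 2 ≤ δ₀ ^ 2 := by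
    have := sq_nonneg ‖fderiv ℝ Φ q₀ qd₀ - f (Φ q₀)‖
    linarith
  have hβ0 : 0 ≤ β := (norm_nonneg _).trans (hβ q₀ (left_mem_segment ℝ _ _))
  have hq2 : h ^ 2 * ‖qd₀‖ ^ 2 ≤ c * (h * δ₀) := by
    have e2 : 0 < ε₀ ^ 2 := by positivity
    have a1 : h ^ 2 * (ε₀ ^ 2 * ‖qd₀‖ ^ 2) ≤ h ^ 2 * δ₀ ^ 2 := by gcongr
    have a2 : (h * δ₀) * (h * δ₀) ≤ (c * ε₀ ^ 2) * (h * δ₀) := by gcongr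
    refine le_of_mul_le_mul_left ?_ e2
    nlinarith
  have hline : ∀ t : ℝ, HasDerivAt (fun t : ℝ => q₀ + t • qd₀) qd₀ t := by
    intro t
    simpa using ((hasDerivAt_id t).smul_const qd₀).const_add q₀
  have hT := taylor_aux y (fun s => f (y s)) dy2 t₀ h c₂ hh hy hy2 hy2b
  have hd1 : Differentiable ℝ Φ := hΦ.differentiable (by norm_num)
  have hd2 : Differentiable ℝ (fderiv ℝ Φ) :=
    (hΦ.fderiv_right (m := 1) (by norm_num)).differentiable (by norm_num)
  have hS := taylor_aux (fun t : ℝ => Φ (q₀ + t • qd₀))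
    (fun t : ℝ => fderiv ℝ Φ (q₀ + t • qd₀) qd₀)
    (fun t : ℝ => fderiv ℝ (fderiv ℝ Φ) (q₀ + t • qd₀) qd₀ qd₀) 0 h (β * ‖qd₀‖ ^ 2 / 2) hh
    (fun t _ => (hd1 _).hasFDerivAt.comp_hasDerivAt t (hline t))
    (fun t _ => by
      exact (ContinuousLinearMap.apply ℝ H qd₀).hasFDerivAt.comp_hasDerivAt t
        ((hd2 (q₀ + t • qd₀)).hasFDerivAt.comp_hasDerivAt t (hline t)))
    (fun t ht => by
      have hmem : q₀ + t • qd₀ ∈ segment ℝ q₀ (q₀ + h • qd₀) := by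
        rw [segment_eq_image']
        refine ⟨t / h, ⟨div_nonneg ht.1 hh.le, (div_le_one hh).2 (by simpa using ht.2)⟩, ?_⟩
        simp [smul_smul, div_mul_cancel₀ _ hh.ne']
      have h3 := (iteratedFDeriv ℝ 2 Φ (q₀ + t • qd₀)).le_opNorm ![qd₀, qd₀]
      rw [iteratedFDeriv_two_apply] at h3
      simp [Fin.prod_univ_two] at h3
      have h4 := mul_le_mul_of_nonneg_right (hβ _ hmem)
        (mul_nonneg (norm_nonneg qd₀) (norm_nonneg qd₀))
      refine (h3.trans h4).trans (le_of_eq ?_)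
      ring)
  simp only [zero_add, zero_smul, add_zero] at hS
  rw [hy0] at hT
  have key : Φ (q₀ + h • qd₀) - y (t₀ + h) =
      (Φ (q₀ + h • qd₀) - Φ q₀ - h • fderiv ℝ Φ q₀ qd₀)
      + h • (fderiv ℝ Φ q₀ qd₀ - f (Φ q₀))
      - (y (t₀ + h) - Φ q₀ - h • f (Φ q₀)) := by
    rw [smul_sub]; abel
  have hN : ‖h • (fderiv ℝ Φ q₀ qd₀ - f (Φ q₀))‖ ≤ h * δ₀ := by
    rw [norm_smul, Real.norm_of_nonneg hh.le]
    gcongr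
  have hfin : β * ‖qd₀‖ ^ 2 / 2 * h ^ 2 ≤ c * β * h * δ₀ := by
    have b1 := mul_le_mul_of_nonneg_left hq2 hβ0
    have b2 : 0 ≤ β * (h ^ 2 * ‖qd₀‖ ^ 2) := by positivity
    nlinarith
  rw [key]
  refine (norm_sub_le _ _).trans ?_
  have := norm_add_le (Φ (q₀ + h • qd₀) - Φ q₀ - h • fderiv ℝ Φ q₀ qd₀)
    (h • (fderiv ℝ Φ q₀ qd₀ - f (Φ q₀)))
  nlinarith
end

section
/- Let P be a symmetric positive semi-definite n×n real matrix and G an m×n real matrix. Let θ > 0 and ρ > 0, and suppose W is an n×k matrix whose columns are orthonormal eigenvectors of P corresponding to eigenvalues ≥ θ, such that ‖(GW)ᵀ v‖ ≥ ρ ‖v‖ for all v ∈ ℝᵐ (i.e. the smallest singular value of GW is at least ρ). Then the m×m matrix G P Gᵀ is invertible and ‖(G P Gᵀ)⁻¹‖₂ ≤ 1/(θ ρ²). -/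
open Matrix

lemma stmt_14_aux {n k : ℕ} (P : Matrix (Fin n) (Fin n) ℝ) (hP : P.PosSemidef)
    (W : Matrix (Fin n) (Fin k) ℝ) (θ : ℝ) (μ : Fin k → ℝ) (hμ : ∀ i, θ ≤ μ i)
    (heig : ∀ i, P *ᵥ (fun r => W r i) = μ i • (fun r => W r i))
    (horth : Wᵀ * W = 1) (x : Fin n → ℝ) :
    θ * ∑ j, (Wᵀ *ᵥ x) j ^ 2 ≤ x ⬝ᵥ (P *ᵥ x) := by
  have hPW : P * W = W * diagonal μ := by
    ext r i
    have := congrFun (heig i) r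
    rw [mul_diagonal]
    simp only [Pi.smul_apply, smul_eq_mul] at this
    rw [mul_comm, ← this]
    rfl
  have hPt : Pᵀ = P := by simpa using hP.isHermitian.eq
  set c := Wᵀ *ᵥ x with hc
  have h1 : P *ᵥ (W *ᵥ c) = W *ᵥ (diagonal μ *ᵥ c) := by
    rw [mulVec_mulVec, hPW, ← mulVec_mulVec]
  have hxW : ∀ z, x ⬝ᵥ (W *ᵥ z) = c ⬝ᵥ z := by
    intro z
    rw [dotProduct_mulVec, hc, mulVec_transpose]
  have hsym : ∀ a b : Fin n → ℝ, a ⬝ᵥ (P *ᵥ b) = b ⬝ᵥ (P *ᵥ a) := by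
    intro a b
    rw [dotProduct_mulVec, ← mulVec_transpose, hPt, dotProduct_comm]
  have hWW : (W *ᵥ c) ⬝ᵥ (W *ᵥ (diagonal μ *ᵥ c)) = c ⬝ᵥ (diagonal μ *ᵥ c) := by
    rw [dotProduct_mulVec, ← mulVec_transpose, mulVec_mulVec, horth, one_mulVec]
  have h0 : 0 ≤ (x - W *ᵥ c) ⬝ᵥ (P *ᵥ (x - W *ᵥ c)) := by
    simpa using hP.dotProduct_mulVec_nonneg (x - W *ᵥ c)
  rw [mulVec_sub, sub_dotProduct, dotProduct_sub, dotProduct_sub, hsym (W *ᵥ c) x, h1, hxW,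
    hWW] at h0
  have h2 : θ * ∑ j, c j ^ 2 ≤ c ⬝ᵥ (diagonal μ *ᵥ c) := by
    simp only [dotProduct, mulVec_diagonal, Finset.mul_sum]
    apply Finset.sum_le_sum
    intro i _
    nlinarith [mul_le_mul_of_nonneg_right (hμ i) (sq_nonneg (c i))]
  linarith

/-- If the columns of `W` are orthonormal eigenvectors of the symmetric positive
semi-definite matrix `P` with eigenvalues `≥ θ`, and the smallest singular value of `GW` is
at least `ρ`, then `G P Gᵀ` is invertible with `‖(G P Gᵀ)⁻¹‖₂ ≤ 1/(θρ²)` (spectral norm,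
stated via Euclidean vector norms). -/
theorem stmt_14 {m n k : ℕ} (P : Matrix (Fin n) (Fin n) ℝ) (hP : P.PosSemidef)
    (G : Matrix (Fin m) (Fin n) ℝ) (W : Matrix (Fin n) (Fin k) ℝ)
    (θ ρ : ℝ) (hθ : 0 < θ) (hρ : 0 < ρ)
    (μ : Fin k → ℝ) (hμ : ∀ i, θ ≤ μ i)
    (heig : ∀ i, P *ᵥ (fun r => W r i) = μ i • (fun r => W r i))
    (horth : Wᵀ * W = 1)
    (hGW : ∀ v : Fin m → ℝ,
      ρ * Real.sqrt (∑ i, v i ^ 2) ≤ Real.sqrt (∑ j, ((G * W)ᵀ *ᵥ v) j ^ 2)) :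
    IsUnit (G * P * Gᵀ) ∧
      ∀ v : Fin m → ℝ,
        Real.sqrt (∑ i, ((G * P * Gᵀ)⁻¹ *ᵥ v) i ^ 2) ≤
          1 / (θ * ρ ^ 2) * Real.sqrt (∑ i, v i ^ 2) := by
  set A := G * P * Gᵀ with hA
  have key : ∀ v : Fin m → ℝ, θ * ρ ^ 2 * ∑ i, v i ^ 2 ≤ v ⬝ᵥ (A *ᵥ v) := by
    intro v
    have h1 := stmt_14_aux P hP W θ μ hμ heig horth (Gᵀ *ᵥ v)
    have h2 : Wᵀ *ᵥ (Gᵀ *ᵥ v) = (G * W)ᵀ *ᵥ v := by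
      rw [mulVec_mulVec, transpose_mul]
    have h3 : (Gᵀ *ᵥ v) ⬝ᵥ (P *ᵥ (Gᵀ *ᵥ v)) = v ⬝ᵥ (A *ᵥ v) := by
      rw [hA, ← mulVec_mulVec, ← mulVec_mulVec, dotProduct_mulVec v G, mulVec_transpose]
    rw [h2, h3] at h1
    have h4 := pow_le_pow_left₀ (by positivity) (hGW v) 2
    rw [mul_pow, Real.sq_sqrt (by positivity), Real.sq_sqrt (by positivity)] at h4
    nlinarith [mul_le_mul_of_nonneg_left h4 hθ.le]
  have hpos : 0 < θ * ρ ^ 2 := by positivity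
  have hu : IsUnit A := by
    rw [← mulVec_injective_iff_isUnit]
    refine (injective_iff_map_eq_zero A.mulVecLin).2 ?_
    intro v hv
    have hk := key v
    rw [mulVecLin_apply] at hv
    rw [hv, dotProduct_zero] at hk
    have hs : ∑ i, v i ^ 2 = 0 :=
      le_antisymm (by nlinarith) (by positivity)
    rw [Finset.sum_eq_zero_iff_of_nonneg (fun i _ => sq_nonneg _)] at hs
    ext i
    simpa using hs i (Finset.mem_univ i)
  refine ⟨hu, fun v => ?_⟩
  have hk := key (A⁻¹ *ᵥ v)
  rw [mulVec_mulVec, mul_nonsing_inv _ ((isUnit_iff_isUnit_det A).1 hu), one_mulVec] at hk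
  have hcs := Real.sum_mul_le_sqrt_mul_sqrt Finset.univ (A⁻¹ *ᵥ v) v
  change (A⁻¹ *ᵥ v) ⬝ᵥ v ≤ _ at hcs
  set u := A⁻¹ *ᵥ v
  have hsq : Real.sqrt (∑ i, u i ^ 2) ^ 2 = ∑ i, u i ^ 2 := Real.sq_sqrt (by positivity)
  rw [← hsq] at hk
  have hs0 := Real.sqrt_nonneg (∑ i, u i ^ 2)
  have ht0 := Real.sqrt_nonneg (∑ i, v i ^ 2)
  rw [one_div, ← div_eq_inv_mul, le_div_iff₀ hpos]
  rcases hs0.eq_or_lt with h | h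
  · rw [← h]; simpa using ht0
  · refine le_of_mul_le_mul_left ?_ h
    nlinarith
end

section
/- Let A be a real m×n matrix and b ∈ ℝᵐ. For α > 0 define x(α) := (AᵀA + αI)⁻¹ Aᵀ b and ϑ(α) := ‖A x(α) − b‖² + α ‖x(α)‖². Then: (i) x(α) is the unique minimizer over x ∈ ℝⁿ of ‖Ax − b‖² + α‖x‖², so ϑ(α) is the minimum value; (ii) ϑ is differentiable on (0, ∞) with ϑ'(α) = ‖x(α)‖²; (iii) α ↦ ‖x(α)‖² is nonincreasing on (0, ∞) (equivalently ϑ''(α) ≤ 0, i.e. ϑ is concave); and (iv) α ↦ ϑ(α)/α is nonincreasing on (0, ∞). -/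
open Matrix

/-- The solution `x(α) = (AᵀA + αI)⁻¹ Aᵀ b` of the regularized least squares problem. -/
noncomputable def xreg {m n : ℕ} (A : Matrix (Fin m) (Fin n) ℝ) (b : Fin m → ℝ) (α : ℝ) :
    Fin n → ℝ :=
  (Aᵀ * A + α • (1 : Matrix (Fin n) (Fin n) ℝ))⁻¹ *ᵥ (Aᵀ *ᵥ b)

/-- The value `ϑ(α) = ‖A x(α) − b‖² + α ‖x(α)‖²` of the regularized least squares
functional at its minimizer. -/
noncomputable def theta {m n : ℕ} (A : Matrix (Fin m) (Fin n) ℝ) (b : Fin m → ℝ) (α : ℝ) :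
    ℝ :=
  (∑ i, ((A *ᵥ xreg A b α - b) i) ^ 2) + α * ∑ j, (xreg A b α j) ^ 2

/-- Invertibility of the regularized normal matrix. -/
theorem reg_det_unit {m n : ℕ} (A : Matrix (Fin m) (Fin n) ℝ) (α : ℝ) (hα : 0 < α) :
    IsUnit (Aᵀ * A + α • (1 : Matrix (Fin n) (Fin n) ℝ)).det := by
  have h1 : (Aᵀ * A).PosSemidef := by
    have := Matrix.posSemidef_conjTranspose_mul_self A
    rwa [Matrix.conjTranspose_eq_transpose_of_trivial] at this
  have h2 : (α • (1 : Matrix (Fin n) (Fin n) ℝ)).PosDef := Matrix.PosDef.one.smul hα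
  exact (Matrix.PosDef.posSemidef_add h1 h2).det_pos.ne'.isUnit

/-- The normal equations. -/
theorem reg_normal {m n : ℕ} (A : Matrix (Fin m) (Fin n) ℝ) (b : Fin m → ℝ) (α : ℝ)
    (hα : 0 < α) : Aᵀ *ᵥ (A *ᵥ xreg A b α - b) + α • xreg A b α = 0 := by
  have h : (Aᵀ * A + α • (1 : Matrix (Fin n) (Fin n) ℝ)) *ᵥ xreg A b α = Aᵀ *ᵥ b := by
    unfold xreg
    rw [Matrix.mulVec_mulVec, Matrix.mul_nonsing_inv _ (reg_det_unit A α hα), Matrix.one_mulVec]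
  rw [Matrix.add_mulVec, Matrix.smul_mulVec, Matrix.one_mulVec, ← Matrix.mulVec_mulVec] at h
  rw [Matrix.mulVec_sub, ← h]
  abel

theorem sum_sq_dot {k : ℕ} (v : Fin k → ℝ) : ∑ i, (v i) ^ 2 = v ⬝ᵥ v := by
  simp [dotProduct, sq]

/-- Completing the square. -/
theorem reg_expand {m n : ℕ} (A : Matrix (Fin m) (Fin n) ℝ) (b : Fin m → ℝ) (α : ℝ)
    (hα : 0 < α) (z : Fin n → ℝ) :
    (∑ i, ((A *ᵥ z - b) i) ^ 2) + α * ∑ j, (z j) ^ 2 =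
      theta A b α + ((∑ i, ((A *ᵥ (z - xreg A b α)) i) ^ 2)
        + α * ∑ j, ((z - xreg A b α) j) ^ 2) := by
  have hN := reg_normal A b α hα
  unfold theta
  generalize xreg A b α = x at *
  obtain ⟨d, rfl⟩ : ∃ d, z = x + d := ⟨z - x, by abel⟩
  have e : A *ᵥ (x + d) - b = (A *ᵥ x - b) + A *ᵥ d := by
    rw [Matrix.mulVec_add]; abel
  have hd := congrArg (fun v => d ⬝ᵥ v) hN
  simp only [dotProduct_add, dotProduct_smul, dotProduct_zero, smul_eq_mul] at hd
  rw [Matrix.dotProduct_mulVec, Matrix.vecMul_transpose] at hd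
  rw [e, add_sub_cancel_left]
  simp only [sum_sq_dot]
  generalize A *ᵥ x - b = r at *
  generalize A *ᵥ d = q at *
  simp only [dotProduct_add, add_dotProduct]
  rw [dotProduct_comm r q, dotProduct_comm x d]
  linear_combination 2 * hd

theorem reg_le {m n : ℕ} (A : Matrix (Fin m) (Fin n) ℝ) (b : Fin m → ℝ) (α : ℝ)
    (hα : 0 < α) (z : Fin n → ℝ) :
    theta A b α ≤ (∑ i, ((A *ᵥ z - b) i) ^ 2) + α * ∑ j, (z j) ^ 2 := by
  rw [reg_expand A b α hα z]
  have : 0 ≤ (∑ i, ((A *ᵥ (z - xreg A b α)) i) ^ 2)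
        + α * ∑ j, ((z - xreg A b α) j) ^ 2 := by positivity
  linarith

theorem reg_lt {m n : ℕ} (A : Matrix (Fin m) (Fin n) ℝ) (b : Fin m → ℝ) (α : ℝ)
    (hα : 0 < α) (z : Fin n → ℝ) (hz : z ≠ xreg A b α) :
    theta A b α < (∑ i, ((A *ᵥ z - b) i) ^ 2) + α * ∑ j, (z j) ^ 2 := by
  rw [reg_expand A b α hα z]
  obtain ⟨j, hj⟩ := Function.ne_iff.mp hz
  have h1 : 0 < ∑ j, ((z - xreg A b α) j) ^ 2 := by
    refine Finset.sum_pos' (fun i _ => sq_nonneg _) ⟨j, Finset.mem_univ _, ?_⟩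
    have : (z - xreg A b α) j ≠ 0 := by simpa [sub_eq_zero] using hj
    positivity
  have : 0 < (∑ i, ((A *ᵥ (z - xreg A b α)) i) ^ 2)
        + α * ∑ j, ((z - xreg A b α) j) ^ 2 := by positivity
  linarith

/-- The supergradient inequality. -/
theorem reg_super {m n : ℕ} (A : Matrix (Fin m) (Fin n) ℝ) (b : Fin m → ℝ) (α β : ℝ)
    (hα : 0 < α) : theta A b α ≤ theta A b β + (α - β) * ∑ j, (xreg A b β j) ^ 2 := by
  have := reg_le A b α hα (xreg A b β)
  have e : theta A b β = (∑ i, ((A *ᵥ xreg A b β - b) i) ^ 2)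
    + β * ∑ j, (xreg A b β j) ^ 2 := rfl
  linarith

theorem reg_cont {m n : ℕ} (A : Matrix (Fin m) (Fin n) ℝ) (b : Fin m → ℝ) (α : ℝ)
    (hα : 0 < α) : ContinuousAt (fun α => ∑ j, (xreg A b α j) ^ 2) α := by
  have hM : Continuous (fun α : ℝ => Aᵀ * A + α • (1 : Matrix (Fin n) (Fin n) ℝ)) := by
    fun_prop
  have hx : ContinuousAt (fun α => xreg A b α) α := by
    have e : (fun α => xreg A b α) = fun α : ℝ =>
        (Aᵀ * A + α • (1 : Matrix (Fin n) (Fin n) ℝ)).det⁻¹ •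
        ((Aᵀ * A + α • (1 : Matrix (Fin n) (Fin n) ℝ)).adjugate *ᵥ (Aᵀ *ᵥ b)) := by
      funext t
      simp only [xreg, Matrix.inv_def, Ring.inverse_eq_inv', Matrix.smul_mulVec]
    rw [e]
    refine ContinuousAt.smul (ContinuousAt.inv₀ hM.matrix_det.continuousAt
      (reg_det_unit A α hα).ne_zero) ?_
    exact (hM.matrix_adjugate.matrix_mulVec continuous_const).continuousAt
  have hc : Continuous (fun v : Fin n → ℝ => ∑ j, (v j) ^ 2) := by fun_prop
  exact hc.continuousAt.comp hx

/-- (i) `x(α)` is the unique minimizer of `x ↦ ‖Ax − b‖² + α‖x‖²`, so `ϑ(α)` is the minimum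
value; (ii) `ϑ'(α) = ‖x(α)‖²`; (iii) `α ↦ ‖x(α)‖²` is nonincreasing on `(0,∞)` (so `ϑ` is
concave); (iv) `α ↦ ϑ(α)/α` is nonincreasing on `(0,∞)`. -/
theorem stmt_18 {m n : ℕ} (A : Matrix (Fin m) (Fin n) ℝ) (b : Fin m → ℝ) :
    (∀ α : ℝ, 0 < α → ∀ z : Fin n → ℝ,
      (theta A b α ≤ (∑ i, ((A *ᵥ z - b) i) ^ 2) + α * ∑ j, (z j) ^ 2) ∧
      (z ≠ xreg A b α →
        theta A b α < (∑ i, ((A *ᵥ z - b) i) ^ 2) + α * ∑ j, (z j) ^ 2)) ∧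
    (∀ α : ℝ, 0 < α → HasDerivAt (theta A b) (∑ j, (xreg A b α j) ^ 2) α) ∧
    (AntitoneOn (fun α => ∑ j, (xreg A b α j) ^ 2) (Set.Ioi 0)) ∧
    (AntitoneOn (fun α => theta A b α / α) (Set.Ioi 0)) := by
  refine ⟨fun α hα z => ⟨reg_le A b α hα z, reg_lt A b α hα z⟩, ?_, ?_, ?_⟩
  · intro α hα
    rw [hasDerivAt_iff_isLittleO, Asymptotics.isLittleO_iff]
    intro c hc
    have h1 := Metric.continuousAt_iff'.mp (reg_cont A b α hα) c hc
    filter_upwards [h1, lt_mem_nhds hα] with β hβ hβ0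
    rw [Real.dist_eq] at hβ
    have u := reg_super A b β α hβ0
    have l := reg_super A b α β hα
    rw [smul_eq_mul, Real.norm_eq_abs, Real.norm_eq_abs]
    generalize (∑ j, (xreg A b α j) ^ 2) = p at *
    generalize (∑ j, (xreg A b β j) ^ 2) = q at *
    have h2 : |theta A b β - theta A b α - (β - α) * p| ≤ |(q - p) * (β - α)| := by
      rw [abs_of_nonpos (by linarith)]
      refine le_trans ?_ (neg_le_abs _)
      linarith
    rw [abs_mul] at h2
    exact h2.trans (mul_le_mul_of_nonneg_right hβ.le (abs_nonneg _))
  · intro α hα β hβ hab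
    rcases hab.eq_or_lt with rfl | hlt
    · exact le_rfl
    have u := reg_super A b β α hβ
    have l := reg_super A b α β hα
    have h : 0 < β - α := by linarith
    refine le_of_mul_le_mul_left ?_ h
    dsimp only
    linarith
  · intro α hα β hβ hab
    have hα' : 0 < α := hα
    have hβ' : 0 < β := hβ
    have h := reg_le A b β hβ (xreg A b α)
    have e : theta A b α = (∑ i, ((A *ᵥ xreg A b α - b) i) ^ 2)
      + α * ∑ j, (xreg A b α j) ^ 2 := rfl
    have hR : 0 ≤ ∑ i, ((A *ᵥ xreg A b α - b) i) ^ 2 := by positivity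
    dsimp only
    rw [div_le_div_iff₀ hβ' hα', e]
    have h3 := mul_le_mul_of_nonneg_right h hα'.le
    have h4 := mul_le_mul_of_nonneg_left hab hR
    linarith
end
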